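/- Let 2 < m < 3, 1 < α ≤ 2, 0 < ε < 1, a > 0, K > 0, and define Λ(t) = t^{−K} − 1, Φ(x,t) = a Λ(t) φ(x) − (|x|²+K)/(16t), H(x,t) = a Λ(t) |x|^{α−2}(α f(h) − h f'(h)) with h = x₁/|x|, and F(x,t) = −4 H(x,t) + 3/t. Then for every t ∈ (0,1), every x ∈ ℝⁿ with x ≠ 0 and x₁ ≥ ε|x|, and every ξ ∈ ℝⁿ: 4⟨D²Φ(x,t) ξ, ξ⟩ + F(x,t) |ξ|² ≥ (5/(2t)) |ξ|², where D²Φ denotes the Hessian of Φ in the x variables. -/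

import Mathlib

/-- `f(h) = h^m - ε^m` (real powers). -/
noncomputable def f (m ε h : ℝ) : ℝ := h ^ m - ε ^ m

/-- `f'(h) = m h^{m-1}`. -/
noncomputable def f' (m h : ℝ) : ℝ := m * h ^ (m - 1)

/-- The Carleman weight `φ(x) = |x|^α ((x₁/|x|)^m − ε^m)`. -/
noncomputable def φ {n : ℕ} (hn : 0 < n) (m ε α : ℝ)
    (x : EuclideanSpace ℝ (Fin n)) : ℝ :=
  ‖x‖ ^ α * ((x ⟨0, hn⟩ / ‖x‖) ^ m - ε ^ m)

/-- `Λ(t) = t^{−K} − 1`. -/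
noncomputable def Lam (K t : ℝ) : ℝ := t ^ (-K) - 1

/-- The full Carleman weight exponent `Φ(x,t) = aΛ(t)φ(x) − (|x|²+K)/(16t)`. -/
noncomputable def Φ {n : ℕ} (hn : 0 < n) (m ε α a K : ℝ)
    (x : EuclideanSpace ℝ (Fin n)) (t : ℝ) : ℝ :=
  a * Lam K t * φ hn m ε α x - (‖x‖ ^ 2 + K) / (16 * t)

/-- `H(x,t) = aΛ(t)|x|^{α−2}(αf(h) − hf'(h))` with `h = x₁/|x|`. -/
noncomputable def H {n : ℕ} (hn : 0 < n) (m ε α a K : ℝ)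
    (x : EuclideanSpace ℝ (Fin n)) (t : ℝ) : ℝ :=
  a * Lam K t * ‖x‖ ^ (α - 2) * (α * f m ε (x ⟨0, hn⟩ / ‖x‖)
    - (x ⟨0, hn⟩ / ‖x‖) * f' m (x ⟨0, hn⟩ / ‖x‖))

/-- The Hessian quadratic form `⟨D²g(x) ξ, ξ⟩` of `g` at `x` applied to `ξ`. -/
noncomputable def hessQ {n : ℕ} (g : EuclideanSpace ℝ (Fin n) → ℝ)
    (x ξ : EuclideanSpace ℝ (Fin n)) : ℝ :=
  iteratedFDeriv ℝ 2 g x ![ξ, ξ]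

open Filter Topology in
lemma hess_line {n : ℕ} (g : EuclideanSpace ℝ (Fin n) → ℝ) (x ξ : EuclideanSpace ℝ (Fin n))
    (hg : ContDiffAt ℝ 2 g x) (γ' : ℝ → ℝ) (d : ℝ)
    (h1 : ∀ᶠ s in 𝓝 (0:ℝ), HasDerivAt (fun s : ℝ => g (x + s • ξ)) (γ' s) s)
    (h2 : HasDerivAt γ' d 0) : hessQ g x ξ = d := by
  have hl : ∀ s : ℝ, HasDerivAt (fun s : ℝ => x + s • ξ) ξ s := by
    intro s
    simpa using ((hasDerivAt_id s).smul_const ξ).const_add x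
  have hlc : Tendsto (fun s : ℝ => x + s • ξ) (𝓝 0) (𝓝 x) := by
    have := (hl 0).continuousAt.tendsto
    simpa using this
  have hd : ∀ᶠ y in 𝓝 x, DifferentiableAt ℝ g y := by
    have := hg.eventually (by simp)
    filter_upwards [this] with y hy
    exact hy.differentiableAt (by simp)
  have hd2 : DifferentiableAt ℝ (fderiv ℝ g) x :=
    (hg.fderiv_right (m := 1) (by norm_num)).differentiableAt (by simp)
  have e : γ' =ᶠ[𝓝 0] fun s => fderiv ℝ g (x + s • ξ) ξ := by
    filter_upwards [h1, hlc.eventually hd] with s hs hds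
    exact hs.unique (hds.hasFDerivAt.comp_hasDerivAt s (hl s))
  have h3 : HasDerivAt (fun s : ℝ => fderiv ℝ g (x + s • ξ) ξ)
      (fderiv ℝ (fderiv ℝ g) x ξ ξ) 0 := by
    have hh : HasFDerivAt (fderiv ℝ g) (fderiv ℝ (fderiv ℝ g) x) (x + (0:ℝ) • ξ) := by
      simpa using hd2.hasFDerivAt
    have := hh.comp_hasDerivAt (0:ℝ) (hl 0)
    simpa using this.clm_apply (hasDerivAt_const (0:ℝ) ξ)
  have := (h2.congr_of_eventuallyEq e.symm).unique h3
  unfold hessQ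
  rw [iteratedFDeriv_two_apply]
  simpa using this.symm

/-- The smooth form of the weight. -/
noncomputable def gs {n : ℕ} (hn : 0 < n) (m e α A K t : ℝ)
    (y : EuclideanSpace ℝ (Fin n)) : ℝ :=
  A * ((‖y‖ ^ 2) ^ ((α - m) / 2) * (y ⟨0, hn⟩) ^ m - e * (‖y‖ ^ 2) ^ (α / 2))
    - (‖y‖ ^ 2 + K) / (16 * t)

lemma pow_form (R u α m : ℝ) (hR : 0 < R) (hu : 0 < u) :
    R ^ α * (u / R) ^ m = (R ^ 2) ^ ((α - m) / 2) * u ^ m := by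
  rw [Real.div_rpow hu.le hR.le, ← Real.rpow_natCast_mul hR.le, Real.rpow_def_of_pos hR α,
    Real.rpow_def_of_pos hR m, Real.rpow_def_of_pos hR]
  rw [mul_div_assoc', mul_comm, mul_div_assoc, ← Real.exp_sub, mul_comm]
  congr 2
  push_cast
  ring

lemma pow_form' (R α : ℝ) (hR : 0 < R) : R ^ α = (R ^ 2) ^ (α / 2) := by
  rw [← Real.rpow_natCast_mul hR.le]
  congr 1
  push_cast
  ring

lemma gs_contDiff {n : ℕ} (hn : 0 < n) (m e α A K t : ℝ)
    (x : EuclideanSpace ℝ (Fin n)) (hx : x ≠ 0) (hx1 : 0 < x ⟨0, hn⟩) :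
    ContDiffAt ℝ 2 (gs hn m e α A K t) x := by
  have h1 : ContDiffAt ℝ 2 (fun y : EuclideanSpace ℝ (Fin n) => ‖y‖ ^ 2) x :=
    (contDiff_norm_sq ℝ).contDiffAt
  have h2 : ContDiffAt ℝ 2 (fun y : EuclideanSpace ℝ (Fin n) => y ⟨0, hn⟩) x := by fun_prop
  have hq : ‖x‖ ^ 2 ≠ 0 := by positivity
  unfold gs
  exact (contDiffAt_const.mul (((h1.rpow_const_of_ne hq).mul
    (h2.rpow_const_of_ne hx1.ne')).sub
    (contDiffAt_const.mul (h1.rpow_const_of_ne hq)))).sub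
    ((h1.add contDiffAt_const).div_const _)

lemma gs_hess {n : ℕ} (hn : 0 < n) (m e α A K t : ℝ)
    (x ξ : EuclideanSpace ℝ (Fin n)) (hx : x ≠ 0) (hx1 : 0 < x ⟨0, hn⟩)
    (Q c N u b : ℝ) (hQ : Q = ‖x‖ ^ 2) (hc : c = inner ℝ x ξ) (hN : N = ‖ξ‖ ^ 2)
    (hu : u = x ⟨0, hn⟩) (hb : b = ξ ⟨0, hn⟩) :
    hessQ (gs hn m e α A K t) x ξ =
      A * (((α - m) * N * Q ^ ((α - m) / 2 - 1)
            + (α - m) * (α - m - 2) * c ^ 2 * Q ^ ((α - m) / 2 - 1 - 1)) * u ^ m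
          + 2 * (α - m) * c * Q ^ ((α - m) / 2 - 1) * (m * b * u ^ (m - 1))
          + Q ^ ((α - m) / 2) * (m * (m - 1) * b ^ 2 * u ^ (m - 1 - 1))
          - e * (α * N * Q ^ (α / 2 - 1) + α * (α - 2) * c ^ 2 * Q ^ (α / 2 - 1 - 1)))
        - N / (8 * t) := by
  set q : ℝ → ℝ := fun s => Q + 2 * c * s + N * s ^ 2 with hqdef
  set q' : ℝ → ℝ := fun s => 2 * c + 2 * N * s with hq'def
  set l : ℝ → ℝ := fun s => u + s * b with hldef
  have hq : ∀ s, HasDerivAt q (q' s) s := by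
    intro s
    have := (((hasDerivAt_id s).const_mul (2 * c)).const_add Q).add
      (((hasDerivAt_id s).pow 2).const_mul N)
    refine this.congr_deriv ?_
    simp [hq'def]; ring
  have hq' : ∀ s, HasDerivAt q' (2 * N) s := by
    intro s
    exact (((hasDerivAt_id s).const_mul (2 * N)).const_add (2 * c)).congr_deriv (by simp)
  have hl : ∀ s, HasDerivAt l b s := by
    intro s
    exact (((hasDerivAt_id s).mul_const b).const_add u).congr_deriv (by simp)
  have hq0 : q 0 = Q := by simp [hqdef]
  have hq'0 : q' 0 = 2 * c := by simp [hq'def]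
  have hl0 : l 0 = u := by simp [hldef]
  have hQp : 0 < Q := by rw [hQ]; positivity
  have hup : 0 < u := by rw [hu]; exact hx1
  have hfun : (fun s : ℝ => gs hn m e α A K t (x + s • ξ)) = fun s =>
      A * (q s ^ ((α - m) / 2) * l s ^ m - e * q s ^ (α / 2)) - (q s + K) / (16 * t) := by
    funext s
    have e1 : ‖x + s • ξ‖ ^ 2 = q s := by
      rw [norm_add_sq_real, inner_smul_right, norm_smul, mul_pow, Real.norm_eq_abs, sq_abs,
        ← hQ, ← hN, ← hc]
      simp only [hqdef]; ring
    have e2 : (x + s • ξ) ⟨0, hn⟩ = l s := by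
      simp [hldef, hu, hb]
    unfold gs
    rw [e1, e2]
  refine hess_line _ x ξ (gs_contDiff hn m e α A K t x hx hx1)
    (fun s => A * ((q' s * ((α - m) / 2) * q s ^ ((α - m) / 2 - 1)) * l s ^ m
      + q s ^ ((α - m) / 2) * (b * m * l s ^ (m - 1))
      - e * (q' s * (α / 2) * q s ^ (α / 2 - 1))) - q' s / (16 * t)) _ ?_ ?_
  · have hqe : ∀ᶠ s in nhds (0:ℝ), 0 < q s :=
      (hq 0).continuousAt.eventually (lt_mem_nhds (by rw [hq0]; exact hQp))
    have hle : ∀ᶠ s in nhds (0:ℝ), 0 < l s :=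
      (hl 0).continuousAt.eventually (lt_mem_nhds (by rw [hl0]; exact hup))
    filter_upwards [hqe, hle] with s hs1 hs2
    rw [hfun]
    exact (((((hq s).rpow_const (Or.inl hs1.ne')).mul
      ((hl s).rpow_const (Or.inl hs2.ne'))).sub
      (((hq s).rpow_const (Or.inl hs1.ne')).const_mul e)).const_mul A).sub
      (((hq s).add_const K).div_const _)
  · have a1 : q 0 ≠ 0 := by rw [hq0]; exact hQp.ne'
    have a2 : l 0 ≠ 0 := by rw [hl0]; exact hup.ne'
    have := ((((((hq' 0).mul_const ((α - m) / 2)).mul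
        ((hq 0).rpow_const (p := (α - m) / 2 - 1) (Or.inl a1))).mul
        ((hl 0).rpow_const (p := m) (Or.inl a2))).add
        (((hq 0).rpow_const (p := (α - m) / 2) (Or.inl a1)).mul
          (((hl 0).rpow_const (p := m - 1) (Or.inl a2)).const_mul (b * m)))).sub
        ((((hq' 0).mul_const (α / 2)).mul
          ((hq 0).rpow_const (p := α / 2 - 1) (Or.inl a1))).const_mul e)).const_mul A |>.sub
        ((hq' 0).div_const (16 * t))
    refine this.congr_deriv ?_
    simp only [hq0, hq'0, hl0, Pi.mul_apply]
    ring

/-- with `F = −4H + 3/t`, for every `t ∈ (0,1)`, every `x ≠ 0` with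
`x₁ ≥ ε|x|`, and every `ξ ∈ ℝⁿ`:
`4⟨D²Φ(x,t)ξ, ξ⟩ + F(x,t)|ξ|² ≥ (5/(2t))|ξ|²`, Hessian taken in the `x` variables. -/
theorem stmt_17 (n : ℕ) (hn : 0 < n) (m α ε a K : ℝ)
    (hm₁ : 2 < m) (hm₂ : m < 3) (hα₁ : 1 < α) (hα₂ : α ≤ 2)
    (hε₁ : 0 < ε) (hε₂ : ε < 1) (ha : 0 < a) (hK : 0 < K)
    (t : ℝ) (ht : t ∈ Set.Ioo (0 : ℝ) 1)
    (x : EuclideanSpace ℝ (Fin n)) (hx : x ≠ 0) (hx₁ : ε * ‖x‖ ≤ x ⟨0, hn⟩)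
    (ξ : EuclideanSpace ℝ (Fin n)) :
    4 * hessQ (fun y => Φ hn m ε α a K y t) x ξ
        + (-4 * H hn m ε α a K x t + 3 / t) * ‖ξ‖ ^ 2
      ≥ (5 / (2 * t)) * ‖ξ‖ ^ 2 := by
  have hR : 0 < ‖x‖ := norm_pos_iff.mpr hx
  have hu : 0 < x ⟨0, hn⟩ := lt_of_lt_of_le (by positivity) hx₁
  obtain ⟨ht0, ht1⟩ := ht
  have hLam : 0 < Lam K t := by
    unfold Lam
    have := Real.one_lt_rpow_of_pos_of_lt_one_of_neg ht0 ht1 (neg_lt_zero.mpr hK)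
    linarith
  have hA : 0 < a * Lam K t := mul_pos ha hLam
  have hev : (fun y => Φ hn m ε α a K y t) =ᶠ[nhds x]
      gs hn m (ε ^ m) α (a * Lam K t) K t := by
    have c1 : ContinuousAt (fun y : EuclideanSpace ℝ (Fin n) => y ⟨0, hn⟩) x := by fun_prop
    have c2 : ∀ᶠ y : EuclideanSpace ℝ (Fin n) in nhds x, 0 < y ⟨0, hn⟩ :=
      c1.eventually (lt_mem_nhds hu)
    have c3 : ∀ᶠ y : EuclideanSpace ℝ (Fin n) in nhds x, 0 < ‖y‖ :=
      continuous_norm.continuousAt.eventually (lt_mem_nhds hR)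
    filter_upwards [c2, c3] with y h2 h3
    simp only [Φ, φ, gs]
    rw [← pow_form _ _ _ _ h3 h2, ← pow_form' _ _ h3]
    ring
  have hh : hessQ (fun y => Φ hn m ε α a K y t) x ξ
      = hessQ (gs hn m (ε ^ m) α (a * Lam K t) K t) x ξ := by
    unfold hessQ
    rw [(Filter.EventuallyEq.iteratedFDeriv ℝ hev 2).eq_of_nhds]
  have hH : H hn m ε α a K x t = a * Lam K t * ((α - m) * ((‖x‖ ^ 2) ^ ((α - m) / 2 - 1)
      * x ⟨0, hn⟩ ^ m) - ε ^ m * α * (‖x‖ ^ 2) ^ (α / 2 - 1)) := by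
    have h1 := pow_form ‖x‖ (x ⟨0, hn⟩) (α - 2) m hR hu
    have h2 := pow_form' ‖x‖ (α - 2) hR
    rw [show (α - 2 - m) / 2 = (α - m) / 2 - 1 by ring] at h1
    rw [show (α - 2) / 2 = α / 2 - 1 by ring] at h2
    rw [← h1, ← h2]
    unfold H f f'
    have h3 : (x ⟨0, hn⟩ / ‖x‖) * (x ⟨0, hn⟩ / ‖x‖) ^ (m - 1) = (x ⟨0, hn⟩ / ‖x‖) ^ m := by
      rw [Real.rpow_sub_one (by positivity)]
      field_simp
    linear_combination (-(a * Lam K t * ‖x‖ ^ (α - 2) * m)) * h3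
  rw [hh, hH, gs_hess hn m (ε ^ m) α (a * Lam K t) K t x ξ hx hu _ _ _ _ _ rfl rfl rfl rfl rfl]
  generalize a * Lam K t = A at *
  have hQ : 0 < ‖x‖ ^ 2 := by positivity
  generalize ‖x‖ ^ 2 = Q at *
  generalize ‖ξ‖ ^ 2 = N at *
  generalize (inner ℝ x ξ : ℝ) = c at *
  generalize x ⟨0, hn⟩ = u at *
  generalize ξ ⟨0, hn⟩ = b at *
  have hP : 0 < Q ^ ((α - m) / 2 - 1 - 1) := Real.rpow_pos_of_pos hQ _
  have hL : 0 < u ^ (m - 1 - 1) := Real.rpow_pos_of_pos hu _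
  have hW : 0 < Q ^ (α / 2 - 1 - 1) := Real.rpow_pos_of_pos hQ _
  have hE : 0 < ε ^ m := Real.rpow_pos_of_pos hε₁ _
  have s1 : Q ^ ((α - m) / 2 - 1) = Q ^ ((α - m) / 2 - 1 - 1) * Q := by
    rw [Real.rpow_sub_one hQ.ne' ((α - m) / 2 - 1)]; field_simp
  have s2 : Q ^ ((α - m) / 2) = Q ^ ((α - m) / 2 - 1 - 1) * Q * Q := by
    rw [← s1, Real.rpow_sub_one hQ.ne' ((α - m) / 2)]; field_simp
  have s3 : u ^ (m - 1) = u ^ (m - 1 - 1) * u := by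
    rw [Real.rpow_sub_one hu.ne' (m - 1)]; field_simp
  have s4 : u ^ m = u ^ (m - 1 - 1) * u * u := by
    rw [← s3, Real.rpow_sub_one hu.ne' m]; field_simp
  rw [s1, s2, s3, s4]
  generalize Q ^ ((α - m) / 2 - 1 - 1) = P at *
  generalize u ^ (m - 1 - 1) = L at *
  generalize Q ^ (α / 2 - 1 - 1) = W at *
  have key : 0 ≤ (m - α) * (m - α + 2) * (u * c) ^ 2 - 2 * (m - α) * m * (u * c) * (Q * b)
      + m * (m - 1) * (Q * b) ^ 2 := by
    have hid : (m - 1) * ((m - α) * (m - α + 2) * (u * c) ^ 2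
        - 2 * (m - α) * m * (u * c) * (Q * b) + m * (m - 1) * (Q * b) ^ 2)
        = m * ((m - 1) * (Q * b) - (m - α) * (u * c)) ^ 2
          + (m - α) * (m + α - 2) * (u * c) ^ 2 := by ring
    have : 0 ≤ m * ((m - 1) * (Q * b) - (m - α) * (u * c)) ^ 2
          + (m - α) * (m + α - 2) * (u * c) ^ 2 := by
      have i1 : 0 ≤ m - α := by linarith
      have i2 : 0 ≤ m + α - 2 := by linarith
      have i3 : 0 ≤ m := by linarith
      positivity
    rw [← hid] at this
    exact nonneg_of_mul_nonneg_right this (by linarith)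
  have k1 : 0 ≤ 4 * (A * P * L) * ((m - α) * (m - α + 2) * (u * c) ^ 2
      - 2 * (m - α) * m * (u * c) * (Q * b) + m * (m - 1) * (Q * b) ^ 2) := by positivity
  have k2 : 0 ≤ 4 * (A * ε ^ m * W) * (α * (2 - α) * c ^ 2) := by
    have i1 : 0 ≤ 2 - α := by linarith
    have i2 : 0 ≤ α := by linarith
    positivity
  have hid : ∀ X : ℝ, 4 * (X - N / (8 * t)) + 3 / t * N - 5 / (2 * t) * N = 4 * X := by
    intro X
    field_simp
    ring
  rw [ge_iff_le, ← sub_nonneg]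
  refine (add_nonneg k1 k2).trans_eq ?_
  rw [add_mul]
  generalize ε ^ m = E at *
  generalize hX : A * (((α - m) * N * (P * Q) + (α - m) * (α - m - 2) * c ^ 2 * P) * (L * u * u)
      + 2 * (α - m) * c * (P * Q) * (m * b * (L * u))
      + P * Q * Q * (m * (m - 1) * b ^ 2 * L)
      - E * (α * N * Q ^ (α / 2 - 1) + α * (α - 2) * c ^ 2 * W)) = X
  linear_combination -hid X
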